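/- arXiv:2510.06521 — 2 statements merged into one kernel-verified Lean document; each statement's English description precedes it below -/
import Mathlib

section
/- For all n ≥ k ≥ 1, the total value of srec over all set partitions of [n] with exactly k blocks equals S_{n,k} · Σ_{a=1}^{k} a(a−1)/2 + Σ_{i=1}^{k−1} ( ((k−i)·i·(i+1)/2) · Σ_{j=1}^{n−k} S_{n−j,k} · i^{j−1} ); that is, Σ_{π ∈ P_{n,k}} srec(π) = S_{n,k} Σ_{a=1}^{k} a(a−1)/2 + Σ_{i=1}^{k−1} ((k−i)i(i+1)/2) Σ_{j=1}^{n−k} S_{n−j,k} i^{j−1}. -/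
open Finset PowerSeries

/-- Restricted growth condition (canonical sequential form of a set partition):
each entry is positive and at most one more than the maximum of the preceding entries
(so the first entry is `1`). -/
def IsRGW {n : ℕ} (π : Fin n → ℕ) : Prop :=
  ∀ i : Fin n, 1 ≤ π i ∧ π i ≤ (Finset.univ.filter (fun j => j < i)).sup π + 1

instance {n : ℕ} (π : Fin n → ℕ) : Decidable (IsRGW π) := by
  unfold IsRGW; infer_instance

/-- `Pnk n k` : the canonical sequential forms of set partitions of `[n]` with exactly
`k` blocks (restricted growth words of length `n` with maximum value `k`);
every such word has entries `≤ n`, so they are all captured as images of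
functions `Fin n → Fin (n+1)`. -/
def Pnk (n k : ℕ) : Finset (Fin n → ℕ) :=
  ((Finset.univ : Finset (Fin n → Fin (n+1))).filter
      (fun π => IsRGW (fun i => (π i : ℕ)) ∧ Finset.univ.sup (fun i => (π i : ℕ)) = k)).image
    (fun π i => (π i : ℕ))

/-- `Pall n` : the canonical sequential forms of all set partitions of `[n]`. -/
def Pall (n : ℕ) : Finset (Fin n → ℕ) :=
  ((Finset.univ : Finset (Fin n → Fin (n+1))).filter
      (fun π => IsRGW (fun i => (π i : ℕ)))).image (fun π i => (π i : ℕ))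

/-- `sreca π a` : the sum of the entries of `π` strictly preceding the position of the
first occurrence of the (record) value `a`: an index `i` precedes that position
iff no `j ≤ i` satisfies `π j = a`. -/
def sreca {n : ℕ} (π : Fin n → ℕ) (a : ℕ) : ℕ :=
  ∑ i ∈ Finset.univ.filter (fun i : Fin n => ∀ j, j ≤ i → π j ≠ a), π i

/-- `srec π` : the sum of `sreca π a` over all record values `a` of `π`
(for a restricted growth word the record values are exactly `1, …, max π`). -/
def srec {n : ℕ} (π : Fin n → ℕ) : ℕ :=
  ∑ a ∈ Finset.Icc 1 (Finset.univ.sup π), sreca π a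

/-- Stirling numbers of the second kind `S_{n,k}`. -/
def stirling2 : ℕ → ℕ → ℕ
  | 0, 0 => 1
  | 0, _ + 1 => 0
  | _ + 1, 0 => 0
  | n + 1, k + 1 => stirling2 n k + (k + 1) * stirling2 n (k + 1)

/-- Bell numbers `B_n`. -/
def bell (n : ℕ) : ℕ := ∑ k ∈ Finset.range (n + 1), stirling2 n k

/-- The formal power series `exp(cx) = Σ_{n≥0} c^n x^n / n!` in `ℚ[[x]]`. -/
noncomputable def expc (c : ℚ) : PowerSeries ℚ :=
  PowerSeries.mk fun n => c ^ n / n.factorial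

/-- The formal exponential `exp(f) = Σ_{m≥0} f^m/m!` of a power series `f` with zero
constant term (then `coeff n (f^m) = 0` for `m > n`, so the truncated sum below is the
full sum). In particular `psExp (expc 1 - 1)` is `exp(exp(x) - 1)`. -/
noncomputable def psExp (f : PowerSeries ℚ) : PowerSeries ℚ :=
  PowerSeries.mk fun n =>
    ∑ m ∈ Finset.range (n + 1), (PowerSeries.coeff n (f ^ m)) / m.factorial

/-- Append a last letter. -/
def sn {n : ℕ} (π : Fin n → ℕ) (c : ℕ) : Fin (n + 1) → ℕ := Fin.snoc (α := fun _ => ℕ) π c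

theorem sn_castSucc {n : ℕ} (π : Fin n → ℕ) (c : ℕ) (i : Fin n) : sn π c i.castSucc = π i := by
  simp [sn]

theorem sn_last {n : ℕ} (π : Fin n → ℕ) (c : ℕ) : sn π c (Fin.last n) = c := by
  simp [sn]

theorem exists_sn {n : ℕ} (π : Fin (n + 1) → ℕ) : ∃ p c, π = sn p c :=
  ⟨fun i => π i.castSucc, π (Fin.last n), by
    funext i
    induction i using Fin.lastCases with
    | last => rw [sn_last]
    | cast i => rw [sn_castSucc]⟩

theorem sn_inj {n : ℕ} {p q : Fin n → ℕ} {c d : ℕ} (h : sn p c = sn q d) : p = q ∧ c = d := by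
  constructor
  · funext i
    have := congrFun h i.castSucc
    rwa [sn_castSucc, sn_castSucc] at this
  · have := congrFun h (Fin.last n)
    rwa [sn_last, sn_last] at this

theorem sup_sn {n : ℕ} (π : Fin n → ℕ) (c : ℕ) :
    Finset.univ.sup (sn π c) = max (Finset.univ.sup π) c := by
  apply le_antisymm
  · apply Finset.sup_le
    intro i _
    induction i using Fin.lastCases with
    | last => rw [sn_last]; exact le_max_right _ _
    | cast i => rw [sn_castSucc]; exact le_max_of_le_left (Finset.le_sup (f := π) (Finset.mem_univ i))
  · apply max_le
    · apply Finset.sup_le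
      intro i _
      rw [← sn_castSucc π c i]
      exact Finset.le_sup (f := sn π c) (Finset.mem_univ _)
    · conv_lhs => rw [← sn_last π c]
      exact Finset.le_sup (f := sn π c) (Finset.mem_univ _)

theorem sup_lt_castSucc {n : ℕ} (π : Fin n → ℕ) (c : ℕ) (i : Fin n) :
    (Finset.univ.filter (fun j => j < i.castSucc)).sup (sn π c) =
      (Finset.univ.filter (fun j => j < i)).sup π := by
  apply le_antisymm
  · apply Finset.sup_le
    intro j hj
    induction j using Fin.lastCases with
    | last =>
      simp only [Finset.mem_filter, Finset.mem_univ, true_and] at hj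
      exact absurd hj (not_lt.2 (Fin.le_last _))
    | cast j =>
      rw [sn_castSucc]
      exact Finset.le_sup (f := π) (by simpa using hj)
  · apply Finset.sup_le
    intro j hj
    rw [← sn_castSucc π c j]
    exact Finset.le_sup (f := sn π c) (by simpa using hj)

theorem sup_lt_last {n : ℕ} (π : Fin n → ℕ) (c : ℕ) :
    (Finset.univ.filter (fun j => j < Fin.last n)).sup (sn π c) = Finset.univ.sup π := by
  apply le_antisymm
  · apply Finset.sup_le
    intro j hj
    induction j using Fin.lastCases with
    | last => simp at hj
    | cast j =>
      rw [sn_castSucc]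
      exact Finset.le_sup (f := π) (Finset.mem_univ _)
  · apply Finset.sup_le
    intro j hj
    rw [← sn_castSucc π c j]
    exact Finset.le_sup (f := sn π c) (by simp [Fin.castSucc_lt_last])

theorem isRGW_sn {n : ℕ} (π : Fin n → ℕ) (c : ℕ) :
    IsRGW (sn π c) ↔ IsRGW π ∧ 1 ≤ c ∧ c ≤ Finset.univ.sup π + 1 := by
  unfold IsRGW
  rw [Fin.forall_fin_succ']
  simp only [sup_lt_castSucc, sup_lt_last, sn_castSucc, sn_last]

theorem IsRGW.sup_le {n : ℕ} {π : Fin n → ℕ} (h : IsRGW π) : Finset.univ.sup π ≤ n := by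
  induction n with
  | zero => simp
  | succ n ih =>
    obtain ⟨p, c, rfl⟩ := exists_sn π
    rw [isRGW_sn] at h
    have := ih h.1
    rw [sup_sn]
    omega

theorem IsRGW.surj {n : ℕ} {π : Fin n → ℕ} (h : IsRGW π) (a : ℕ) (h1 : 1 ≤ a)
    (h2 : a ≤ Finset.univ.sup π) : ∃ j, π j = a := by
  induction n with
  | zero => simp at h2; omega
  | succ n ih =>
    obtain ⟨p, c, rfl⟩ := exists_sn π
    rw [isRGW_sn] at h
    rw [sup_sn] at h2
    by_cases hp : a ≤ Finset.univ.sup p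
    · obtain ⟨j, hj⟩ := ih h.1 hp
      exact ⟨j.castSucc, by rw [sn_castSucc, hj]⟩
    · exact ⟨Fin.last n, by rw [sn_last]; omega⟩

theorem mem_Pnk {n k : ℕ} (π : Fin n → ℕ) :
    π ∈ Pnk n k ↔ IsRGW π ∧ Finset.univ.sup π = k := by
  unfold Pnk
  simp only [Finset.mem_image, Finset.mem_filter, Finset.mem_univ, true_and]
  constructor
  · rintro ⟨p, hp, rfl⟩
    exact hp
  · intro h
    refine ⟨fun i => ⟨π i, ?_⟩, h, rfl⟩
    exact Nat.lt_succ_of_le ((Finset.le_sup (f := π) (Finset.mem_univ i)).trans h.1.sup_le)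

theorem Pnk_succ (n k : ℕ) : Pnk (n + 1) (k + 1) =
    ((Pnk n (k + 1) ×ˢ Finset.Icc 1 (k + 1)) ∪ (Pnk n k ×ˢ {k + 1})).image
      (fun p => sn p.1 p.2) := by
  ext π
  obtain ⟨p, c, rfl⟩ := exists_sn π
  rw [mem_Pnk, isRGW_sn, sup_sn]
  simp only [Finset.mem_image, Finset.mem_union, Finset.mem_product, mem_Pnk, Finset.mem_Icc,
    Finset.mem_singleton, Prod.exists]
  constructor
  · rintro ⟨⟨h1, h2, h3⟩, h4⟩
    refine ⟨p, c, ?_, rfl⟩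
    by_cases h : Finset.univ.sup p = k + 1
    · left; exact ⟨⟨h1, h⟩, h2, by omega⟩
    · right; exact ⟨⟨h1, by omega⟩, by omega⟩
  · rintro ⟨q, d, h, e⟩
    obtain ⟨rfl, rfl⟩ := sn_inj e
    rcases h with ⟨⟨h1, h2⟩, h3, h4⟩ | ⟨⟨h1, h2⟩, h3⟩
    · exact ⟨⟨h1, h3, by omega⟩, by omega⟩
    · exact ⟨⟨h1, by omega, by omega⟩, by omega⟩

theorem sum_Pnk_succ (n k : ℕ) (f : (Fin (n + 1) → ℕ) → ℕ) :
    ∑ π ∈ Pnk (n + 1) (k + 1), f π =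
      ∑ π ∈ Pnk n (k + 1), ∑ c ∈ Finset.Icc 1 (k + 1), f (sn π c) +
        ∑ π ∈ Pnk n k, f (sn π (k + 1)) := by
  rw [Pnk_succ, Finset.sum_image, Finset.sum_union, Finset.sum_product, Finset.sum_product]
  · simp
  · rw [Finset.disjoint_left]
    rintro ⟨p, c⟩ h1 h2
    simp only [Finset.mem_product, mem_Pnk] at h1 h2
    omega
  · rintro ⟨p, c⟩ _ ⟨q, d⟩ _ h
    obtain ⟨h1, h2⟩ := sn_inj h
    exact Prod.ext h1 h2

theorem Pnk_succ_zero (n : ℕ) : Pnk (n + 1) 0 = ∅ := by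
  ext π
  rw [mem_Pnk]
  simp only [Finset.notMem_empty, iff_false, not_and]
  intro h h2
  have := (h 0).1
  have := Finset.le_sup (f := π) (Finset.mem_univ 0)
  omega

theorem Pnk_zero_succ (k : ℕ) : Pnk 0 (k + 1) = ∅ := by
  ext π
  rw [mem_Pnk]
  simp

theorem card_Pnk_zero : (Pnk 0 0).card = 1 := by
  rw [Finset.card_eq_one]
  refine ⟨Fin.elim0, ?_⟩
  ext π
  rw [mem_Pnk]
  simp [IsRGW, eq_iff_true_of_subsingleton]

theorem card_Pnk (n k : ℕ) : (Pnk n k).card = stirling2 n k := by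
  induction n generalizing k with
  | zero =>
    cases k with
    | zero => rw [card_Pnk_zero]; rfl
    | succ k => rw [Pnk_zero_succ]; rfl
  | succ n ih =>
    cases k with
    | zero => rw [Pnk_succ_zero]; rfl
    | succ k =>
      rw [Finset.card_eq_sum_ones, sum_Pnk_succ]
      simp only [Finset.sum_const, Nat.card_Icc, smul_eq_mul, ih, stirling2]
      simp
      ring

theorem sreca_sn {n : ℕ} (π : Fin n → ℕ) (c a : ℕ) :
    sreca (sn π c) a = sreca π a + if (∀ j, π j ≠ a) ∧ c ≠ a then c else 0 := by
  unfold sreca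
  rw [Finset.sum_filter, Fin.sum_univ_castSucc, Finset.sum_filter]
  congr 1
  · apply Finset.sum_congr rfl
    intro i _
    rw [sn_castSucc]
    congr 1
    apply propext
    rw [Fin.forall_fin_succ']
    simp only [sn_castSucc, sn_last, Fin.castSucc_le_castSucc_iff]
    constructor
    · exact fun h => h.1
    · exact fun h => ⟨h, fun h' => absurd h' (not_le.2 (Fin.castSucc_lt_last i))⟩
  · rw [sn_last]
    congr 1
    apply propext
    rw [Fin.forall_fin_succ']
    simp [sn_castSucc, sn_last, Fin.le_last]

theorem srec_sn_old {n : ℕ} {π : Fin n → ℕ} (h : IsRGW π) (c : ℕ)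
    (hc : c ≤ Finset.univ.sup π) : srec (sn π c) = srec π := by
  unfold srec
  rw [sup_sn, max_eq_left hc]
  apply Finset.sum_congr rfl
  intro a ha
  rw [Finset.mem_Icc] at ha
  obtain ⟨j, hj⟩ := h.surj a ha.1 ha.2
  rw [sreca_sn, if_neg, add_zero]
  exact fun h => h.1 j hj

theorem srec_sn_new {n : ℕ} {π : Fin n → ℕ} (h : IsRGW π) :
    srec (sn π (Finset.univ.sup π + 1)) = srec π + ∑ i, π i := by
  unfold srec
  rw [sup_sn, max_eq_right (by omega), Finset.sum_Icc_succ_top (by omega)]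
  congr 1
  · apply Finset.sum_congr rfl
    intro a ha
    rw [Finset.mem_Icc] at ha
    obtain ⟨j, hj⟩ := h.surj a ha.1 ha.2
    rw [sreca_sn, if_neg, add_zero]
    exact fun h => h.1 j hj
  · rw [sreca_sn, if_neg (by simp), add_zero]
    unfold sreca
    rw [Finset.filter_true_of_mem]
    intro i _ j _ hj
    have := Finset.le_sup (f := π) (Finset.mem_univ j)
    omega

/-- Triangular numbers. -/
def tri (i : ℕ) : ℕ := i * (i + 1) / 2

theorem two_tri (i : ℕ) : 2 * tri i = i * (i + 1) :=
  Nat.mul_div_cancel' (Nat.even_mul_succ_self i).two_dvd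

theorem tri_succ (i : ℕ) : tri (i + 1) = tri i + (i + 1) := by
  have h1 := two_tri i
  have h2 := two_tri (i + 1)
  nlinarith

theorem sum_Icc_tri (k : ℕ) : ∑ c ∈ Finset.Icc 1 k, c = tri k := by
  induction k with
  | zero => rfl
  | succ k ih => rw [Finset.sum_Icc_succ_top (by omega), ih, tri_succ]

/-- Total of the entries. -/
def totM (n k : ℕ) : ℕ := ∑ π ∈ Pnk n k, ∑ i, π i

/-- Total of srec. -/
def totT (n k : ℕ) : ℕ := ∑ π ∈ Pnk n k, srec π

theorem totM_succ (n k : ℕ) : totM (n + 1) (k + 1) =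
    (k + 1) * totM n (k + 1) + stirling2 n (k + 1) * tri (k + 1) + totM n k +
      stirling2 n k * (k + 1) := by
  unfold totM
  rw [sum_Pnk_succ]
  have h : ∀ π : Fin n → ℕ, ∑ c ∈ Finset.Icc 1 (k + 1), ∑ i, sn π c i =
      (k + 1) * ∑ i, π i + tri (k + 1) := by
    intro π
    simp only [Fin.sum_univ_castSucc, sn_castSucc, sn_last]
    rw [Finset.sum_add_distrib, sum_Icc_tri]
    simp
  have h' : ∀ π : Fin n → ℕ, ∑ i, sn π (k + 1) i = ∑ i, π i + (k + 1) := by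
    intro π
    simp only [Fin.sum_univ_castSucc, sn_castSucc, sn_last]
  rw [Finset.sum_congr rfl (fun π _ => h π), Finset.sum_congr rfl (fun π _ => h' π),
    Finset.sum_add_distrib, Finset.sum_add_distrib, ← Finset.mul_sum, Finset.sum_const,
    Finset.sum_const, card_Pnk, card_Pnk, smul_eq_mul, smul_eq_mul]
  ring

theorem totT_succ (n k : ℕ) : totT (n + 1) (k + 1) =
    (k + 1) * totT n (k + 1) + totT n k + totM n k := by
  unfold totT totM
  rw [sum_Pnk_succ, add_assoc, ← Finset.sum_add_distrib, Finset.mul_sum]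
  congr 1
  · apply Finset.sum_congr rfl
    intro π hπ
    rw [mem_Pnk] at hπ
    rw [Finset.sum_congr rfl (g := fun _ => srec π)]
    · simp
    · intro c hc
      rw [Finset.mem_Icc] at hc
      exact srec_sn_old hπ.1 c (by omega)
  · apply Finset.sum_congr rfl
    intro π hπ
    rw [mem_Pnk] at hπ
    rw [← hπ.2]
    exact srec_sn_new hπ.1

/-- The inner sums. -/
def uu (i k : ℕ) : ℕ → ℕ
  | 0 => 0
  | n + 1 => stirling2 n k + i * uu i k n

theorem uu_rec (i k n : ℕ) :
    uu i (k + 1) (n + 1) = (k + 1) * uu i (k + 1) n + uu i k n := by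
  induction n with
  | zero => simp [uu, stirling2]
  | succ n ih =>
    change stirling2 (n + 1) (k + 1) + i * uu i (k + 1) (n + 1) =
      (k + 1) * (stirling2 n (k + 1) + i * uu i (k + 1) n) + (stirling2 n k + i * uu i k n)
    rw [ih, stirling2]
    ring

theorem uu_self (k n : ℕ) : uu (k + 1) k n = stirling2 n (k + 1) := by
  induction n with
  | zero => rfl
  | succ n ih => rw [uu, ih, stirling2]

theorem stirling2_eq_zero (n k : ℕ) (h : n < k) : stirling2 n k = 0 := by
  induction n generalizing k with
  | zero => cases k with
    | zero => omega
    | succ k => rfl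
  | succ n ih => cases k with
    | zero => omega
    | succ k => rw [stirling2, ih k (by omega), ih (k + 1) (by omega)]; simp

theorem uu_eq_zero (i k n : ℕ) (h : n ≤ k) : uu i k n = 0 := by
  induction n with
  | zero => rfl
  | succ n ih => rw [uu, ih (by omega), stirling2_eq_zero _ _ (by omega)]; simp

theorem uu_eq (i k m : ℕ) :
    uu i k (k + m) = ∑ j ∈ Finset.range m, stirling2 (k + m - (j + 1)) k * i ^ j := by
  induction m with
  | zero => simp [uu_eq_zero]
  | succ m ih =>
    rw [← add_assoc, uu, ih, Finset.sum_range_succ', Finset.mul_sum, add_comm]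
    congr 1
    · apply Finset.sum_congr rfl
      intro j _
      rw [show k + m + 1 - (j + 1 + 1) = k + m - (j + 1) by omega]
      ring
    · simp

theorem totM_eq (n k : ℕ) : totM n k =
    stirling2 n k * tri k + ∑ i ∈ Finset.range k, tri (i + 1) * uu (i + 1) k n := by
  induction n generalizing k with
  | zero => simp [totM, uu]; cases k <;> simp [stirling2, tri]
  | succ n ih =>
    cases k with
    | zero => simp [totM, Pnk_succ_zero, stirling2]
    | succ k =>
      rw [totM_succ, ih, ih]
      simp only [uu_rec, mul_add, Finset.sum_add_distrib]
      rw [Finset.sum_range_succ (fun i => tri (i + 1) * uu (i + 1) k n), uu_self]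
      simp only [mul_left_comm _ (k + 1) _]
      rw [← Finset.mul_sum, stirling2, tri_succ]
      ring

theorem totT_eq (n k : ℕ) : totT n k =
    stirling2 n k * (∑ a ∈ Finset.range k, tri a) +
      ∑ i ∈ Finset.range k, (k - (i + 1)) * tri (i + 1) * uu (i + 1) k n := by
  induction n generalizing k with
  | zero => simp [totT, srec, sreca, uu]; cases k <;> simp [stirling2]
  | succ n ih =>
    cases k with
    | zero => simp [totT, Pnk_succ_zero, stirling2]
    | succ k =>
      rw [totT_succ, ih, ih, totM_eq]
      have h : ∑ i ∈ Finset.range (k + 1),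
            (k + 1 - (i + 1)) * tri (i + 1) * uu (i + 1) k n =
          ∑ i ∈ Finset.range k, (k - (i + 1)) * tri (i + 1) * uu (i + 1) k n +
            ∑ i ∈ Finset.range k, tri (i + 1) * uu (i + 1) k n := by
        rw [Finset.sum_range_succ, Nat.sub_self, ← Finset.sum_add_distrib]
        simp only [zero_mul, add_zero]
        apply Finset.sum_congr rfl
        intro i hi
        rw [Finset.mem_range] at hi
        rw [show k + 1 - (i + 1) = (k - (i + 1)) + 1 by omega]
        ring
      simp only [uu_rec, mul_add, Finset.sum_add_distrib]
      rw [h]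
      simp only [mul_left_comm _ (k + 1) (uu _ _ _)]
      rw [← Finset.mul_sum, stirling2, Finset.sum_range_succ tri]
      ring

/-- For `n ≥ k ≥ 1`, the total value of `srec` over all set partitions
of `[n]` with exactly `k` blocks equals
`S_{n,k} Σ_{a=1}^{k} a(a-1)/2
  + Σ_{i=1}^{k-1} ((k-i)i(i+1)/2) Σ_{j=1}^{n-k} S_{n-j,k} i^{j-1}`.
(The divisions by `2` are exact, so natural number division is used.) -/
theorem sum_elements_record_total_eq (n k : ℕ) (hk : 1 ≤ k) (hn : k ≤ n) :
    ∑ π ∈ Pnk n k, srec π =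
      stirling2 n k * (∑ a ∈ Finset.Icc 1 k, a * (a - 1) / 2) +
        ∑ i ∈ Finset.Icc 1 (k - 1),
          ((k - i) * i * (i + 1) / 2) *
            ∑ j ∈ Finset.Icc 1 (n - k), stirling2 (n - j) k * i ^ (j - 1) := by
  have h0 : ∑ π ∈ Pnk n k, srec π = totT n k := rfl
  rw [h0, totT_eq]
  obtain ⟨m, rfl⟩ := Nat.exists_eq_add_of_le hn
  obtain ⟨k, rfl⟩ := Nat.exists_eq_add_of_le' hk
  congr 1
  · congr 1
    rw [Finset.range_eq_Ico, ← Finset.sum_Ico_add_right_sub_eq 0 (k + 1) 1]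
    refine Finset.sum_congr (by ext x; simp only [Finset.mem_Ico, Finset.mem_Icc]; omega) ?_
    intro a ha
    rw [Finset.mem_Icc] at ha
    unfold tri
    rw [show a - 1 + 1 = a by omega, mul_comm]
  · rw [Finset.sum_range_succ]
    simp only [Nat.sub_self, zero_mul, add_zero, Nat.add_sub_cancel, Nat.add_sub_cancel_left]
    rw [Finset.range_eq_Ico, ← Finset.sum_Ico_add_right_sub_eq 0 k 1]
    refine Finset.sum_congr (by ext x; simp only [Finset.mem_Ico, Finset.mem_Icc]; omega) ?_
    intro i hi
    rw [Finset.mem_Icc] at hi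
    rw [show i - 1 + 1 = i by omega, uu_eq]
    congr 1
    · unfold tri
      rw [mul_assoc, Nat.mul_div_assoc _ (Nat.even_mul_succ_self i).two_dvd]
    · rw [Finset.range_eq_Ico, ← Finset.sum_Ico_add_right_sub_eq 0 m 1]
      refine Finset.sum_congr (by ext x; simp only [Finset.mem_Ico, Finset.mem_Icc]; omega) ?_
      intro j hj
      rw [Finset.mem_Icc] at hj
      rw [show j - 1 + 1 = j by omega]
end

section
/- In the ring of formal power series ℚ[[x]], x · exp(2x) · exp(exp(x) − 1) = Σ_{n≥0} n·(B_{n+1} − B_n) · x^n/n!, where exp(cx) denotes the formal power series Σ_{n≥0} c^n x^n/n!. -/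
open Finset PowerSeries

theorem aux_expc_one : expc 1 = PowerSeries.exp ℚ := by
  ext n; simp [expc, PowerSeries.coeff_exp]

theorem aux_expc_two : expc 2 = expc 1 * expc 1 := by
  rw [aux_expc_one, ← pow_two, PowerSeries.exp_pow_eq_rescale_exp]
  ext n; simp [expc, PowerSeries.coeff_exp, PowerSeries.coeff_rescale, div_eq_mul_inv]

theorem aux_deriv_expc : derivative ℚ (expc 1) = expc 1 := by
  ext n
  simp only [expc, PowerSeries.coeff_derivative, PowerSeries.coeff_mk, Nat.factorial_succ]
  have : (n.factorial : ℚ) ≠ 0 := by positivity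
  have : (n : ℚ) + 1 ≠ 0 := by positivity
  push_cast
  field_simp
  simp

theorem aux_deriv_pow (m : ℕ) : derivative ℚ ((expc 1 - 1) ^ (m + 1)) =
    ((m : ℚ) + 1) • ((expc 1 - 1) ^ m * expc 1) := by
  rw [Derivation.leibniz_pow, map_sub, aux_deriv_expc]
  simp [← Nat.cast_smul_eq_nsmul ℚ]

theorem aux_coeff (n : ℕ) : ∀ m : ℕ, PowerSeries.coeff n ((expc 1 - 1) ^ m) / m.factorial =
    (stirling2 n m : ℚ) / n.factorial := by
  have h0 : PowerSeries.constantCoeff (expc 1 - 1) = 0 := by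
    rw [← PowerSeries.coeff_zero_eq_constantCoeff_apply]; simp [expc]
  induction n with
  | zero =>
    rintro (_ | m)
    · simp [stirling2]
    · simp [stirling2, h0]
  | succ n ih =>
    rintro (_ | m)
    · simp [stirling2, PowerSeries.coeff_one]
    · have h := congrArg (PowerSeries.coeff n) (aux_deriv_pow m)
      have e : (expc 1 - 1) ^ m * expc 1 = (expc 1 - 1) ^ (m + 1) + (expc 1 - 1) ^ m := by ring
      rw [e, PowerSeries.coeff_derivative, PowerSeries.coeff_smul, map_add, smul_eq_mul] at h
      have h1 := ih m
      have h2 := ih (m + 1)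
      simp only [stirling2, Nat.factorial_succ] at *
      push_cast at *
      have a1 : (n.factorial : ℚ) ≠ 0 := by positivity
      have a2 : (n : ℚ) + 1 ≠ 0 := by positivity
      have a3 : (m.factorial : ℚ) ≠ 0 := by positivity
      have a4 : (m : ℚ) + 1 ≠ 0 := by positivity
      rw [div_eq_div_iff (by positivity) (by positivity)] at *
      linear_combination (n.factorial : ℚ) * h + (m + 1 : ℚ) * h1 + (m + 1 : ℚ) * h2

theorem aux_stirling_zero (n : ℕ) : ∀ m, n < m → stirling2 n m = 0 := by
  induction n with
  | zero => rintro (_ | m) h <;> simp_all [stirling2]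
  | succ n ih =>
    rintro (_ | m) h
    · omega
    · simp [stirling2, ih m (by omega), ih (m + 1) (by omega)]

theorem aux_coeff_psExp (n : ℕ) :
    PowerSeries.coeff n (psExp (expc 1 - 1)) = (bell n : ℚ) / n.factorial := by
  simp only [psExp, PowerSeries.coeff_mk, aux_coeff, bell]
  rw [← Finset.sum_div]; push_cast; rfl

/-- Partial sums of the exponential. -/
noncomputable def auxP (N : ℕ) : PowerSeries ℚ :=
  ∑ m ∈ Finset.range N, ((m.factorial : ℚ)⁻¹) • (expc 1 - 1) ^ m

theorem aux_coeff_P (n N : ℕ) (h : n < N) :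
    PowerSeries.coeff n (auxP N) = PowerSeries.coeff n (psExp (expc 1 - 1)) := by
  have : ∀ m, PowerSeries.coeff n (((m.factorial : ℚ)⁻¹) • (expc 1 - 1) ^ m) =
      (stirling2 n m : ℚ) / n.factorial := by
    intro m
    rw [← aux_coeff, PowerSeries.coeff_smul, smul_eq_mul]; ring
  rw [auxP, map_sum]
  simp only [this, psExp, PowerSeries.coeff_mk, aux_coeff]
  symm
  apply Finset.sum_subset
  · intro x; simp; omega
  · intro x _ hx
    rw [aux_stirling_zero n x (by simpa using hx)]; simp

theorem aux_deriv_P (N : ℕ) : derivative ℚ (auxP (N + 1)) = auxP N * expc 1 := by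
  rw [auxP, Finset.sum_range_succ', map_add, map_sum, auxP, Finset.sum_mul]
  simp only [Derivation.map_smul, aux_deriv_pow, smul_smul]
  simp only [pow_zero, Derivation.map_one_eq_zero, smul_zero, add_zero, smul_mul_assoc]
  refine Finset.sum_congr rfl fun m _ => ?_
  congr 1
  rw [Nat.factorial_succ]
  have : (m : ℚ) + 1 ≠ 0 := by positivity
  have a3 : (m.factorial : ℚ) ≠ 0 := by positivity
  push_cast
  field_simp

theorem aux_deriv_psExp :
    derivative ℚ (psExp (expc 1 - 1)) = psExp (expc 1 - 1) * expc 1 := by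
  ext n
  have h := congrArg (PowerSeries.coeff n) (aux_deriv_P (n + 1))
  rw [PowerSeries.coeff_derivative, aux_coeff_P _ _ (by omega)] at h
  rw [PowerSeries.coeff_derivative, h, PowerSeries.coeff_mul, PowerSeries.coeff_mul]
  refine Finset.sum_congr rfl fun p hp => ?_
  rw [aux_coeff_P _ _ (by have := Finset.HasAntidiagonal.mem_antidiagonal.mp hp; omega)]

/-- In `ℚ[[x]]`,
`x e^{2x} exp(eˣ - 1) = Σ_{n≥0} n (B_{n+1} - B_n) xⁿ/n!`,
where `expc c = Σ_{n≥0} cⁿxⁿ/n!` and `psExp (expc 1 - 1) = exp(exp(x)-1)`. -/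
theorem bell_egf_xe2x :
    PowerSeries.X * expc 2 * psExp (expc 1 - 1) =
      PowerSeries.mk (fun n =>
        (n : ℚ) * ((bell (n+1) : ℚ) - (bell n : ℚ)) / n.factorial) := by
  have key : expc 2 * psExp (expc 1 - 1) =
      derivative ℚ (derivative ℚ (psExp (expc 1 - 1))) -
        derivative ℚ (psExp (expc 1 - 1)) := by
    rw [aux_deriv_psExp, Derivation.leibniz, aux_deriv_expc, aux_deriv_psExp, aux_expc_two,
      smul_eq_mul, smul_eq_mul]
    ring
  rw [mul_assoc, key]
  ext n
  rcases n with _ | n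
  · simp
  · rw [PowerSeries.coeff_succ_X_mul, map_sub]
    simp only [PowerSeries.coeff_derivative, aux_coeff_psExp, PowerSeries.coeff_mk,
      Nat.factorial_succ]
    have a1 : (n.factorial : ℚ) ≠ 0 := by positivity
    have a2 : (n : ℚ) + 1 ≠ 0 := by positivity
    have a3 : (n : ℚ) + 1 + 1 ≠ 0 := by positivity
    push_cast
    field_simp
end
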